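/- arXiv:2004.14504 — 2 statements merged into one kernel-verified Lean document; each statement's English description precedes it below -/
import Mathlib

section
/- The map (x, g) ↦ χ_x(g), from the product of the space of Hermitian d×d matrices with GL(d,ℂ) to the positive reals, is continuous, and it is invariant under the unitary group action k·(x,g) = (k x k*, g k⁻¹): for every unitary k, every Hermitian x and every g ∈ GL(d,ℂ), χ_{k x k*}(g k⁻¹) = χ_x(g). -/
open Matrix
open scoped ComplexOrder

noncomputable section
open scoped Classical

/-- Square complex matrices of size `d`. -/
abbrev Mat (d : ℕ) := Matrix (Fin d) (Fin d) ℂ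

/-- `n` is upper triangular with all diagonal entries equal to `1`. -/
def IsUnitUpperTriangular {d : ℕ} (n : Mat d) : Prop :=
  n.BlockTriangular (id : Fin d → Fin d) ∧ ∀ i, n i i = 1

/-- `a` is diagonal with positive real diagonal entries. -/
def IsPosDiagonal {d : ℕ} (a : Mat d) : Prop :=
  ∃ f : Fin d → ℝ, (∀ i, 0 < f i) ∧ a = Matrix.diagonal (fun i => (f i : ℂ))

/-- `(k, a, n)` is an Iwasawa (QR) decomposition of `g`: `g = k a n` with `k` unitary,
`a` diagonal with positive real diagonal entries and `n` unit upper triangular. -/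
def IsIwasawa {d : ℕ} (g k a n : Mat d) : Prop :=
  g = k * a * n ∧ k ∈ Matrix.unitaryGroup (Fin d) ℂ ∧ IsPosDiagonal a ∧ IsUnitUpperTriangular n

/-- A choice of the (unique) Iwasawa decomposition `(k(g), a(g), n(g))` of `g`. -/
def iwaTriple {d : ℕ} (g : Mat d) : Mat d × Mat d × Mat d :=
  if h : ∃ t : Mat d × Mat d × Mat d, IsIwasawa g t.1 t.2.1 t.2.2 then h.choose else (1, 1, 1)

/-- The unitary factor `k(g)` in the Iwasawa decomposition of `g`. -/
def iwaK {d : ℕ} (g : Mat d) : Mat d := (iwaTriple g).1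

/-- `α(g) = log a(g)`, a real diagonal matrix. -/
def iwaAlpha {d : ℕ} (g : Mat d) : Matrix (Fin d) (Fin d) ℝ :=
  Matrix.diagonal (fun i => Real.log (((iwaTriple g).2.1 i i).re))

/-- `x = h * diagonal f * h*` with `h` unitary and `f` real and nonincreasing. -/
def IsOrderedDiagonalization {d : ℕ} (x : Mat d) (h : Mat d) (f : Fin d → ℝ) : Prop :=
  h ∈ Matrix.unitaryGroup (Fin d) ℂ ∧ Antitone f ∧
    x = h * Matrix.diagonal (fun i => (f i : ℂ)) * star h

/-- A choice of an ordered spectral decomposition `x = h x₀ h*` of a hermitian matrix. -/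
def specPair {d : ℕ} (x : Mat d) : Mat d × (Fin d → ℝ) :=
  if h : ∃ p : Mat d × (Fin d → ℝ), IsOrderedDiagonalization x p.1 p.2 then h.choose else (1, 0)

/-- `χ_x(g) = exp (2 Tr (x₀ α(g h)))` where `x = h x₀ h*` (independent of the choice of `h`). -/
def chi {d : ℕ} (x g : Mat d) : ℝ :=
  Real.exp (2 * Matrix.trace (Matrix.diagonal (specPair x).2 * iwaAlpha (g * (specPair x).1)))

/-- The leading principal minor of order `j`. -/
def leadMinor {d : ℕ} (M : Mat d) (j : ℕ) : ℂ :=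
  (M.toSquareBlockProp (fun i : Fin d => (i : ℕ) < j)).det

/-- The sum `∑ i, f i * log (D_{i+1} / D_i)`, where `D_j` is the leading minor of order `j`. -/
def minorPairing {d : ℕ} (f : Fin d → ℝ) (M : Mat d) : ℝ :=
  ∑ i : Fin d, f i * (Real.log (leadMinor M (i + 1)).re - Real.log (leadMinor M i).re)

theorem toSquareBlockProp_mul_of_cross_zero {d : ℕ} {A B : Mat d} {p : Fin d → Prop}
    [DecidablePred p] (h : ∀ i j k, p i → p j → ¬ p k → A i k * B k j = 0) :
    (A * B).toSquareBlockProp p = A.toSquareBlockProp p * B.toSquareBlockProp p := by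
  ext ⟨i, hi⟩ ⟨j, hj⟩
  simp only [Matrix.toSquareBlockProp_def, Matrix.mul_apply, Matrix.of_apply]
  rw [← Fintype.sum_subtype_add_sum_subtype p (fun k => A i k * B k j)]
  rw [Finset.sum_eq_zero (s := (Finset.univ : Finset {k // ¬ p k}))
    (fun k _ => h i j k hi hj k.2), add_zero]

theorem leadMinor_conj {d : ℕ} {M u : Mat d} {j : ℕ}
    (h : ∀ i k : Fin d, (i : ℕ) < j → ¬ (k : ℕ) < j → u k i = 0) :
    leadMinor (uᴴ * M * u) j =
      star (leadMinor u j) * leadMinor M j * leadMinor u j := by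
  unfold leadMinor
  rw [toSquareBlockProp_mul_of_cross_zero, toSquareBlockProp_mul_of_cross_zero, Matrix.det_mul,
    Matrix.det_mul, ← Matrix.det_conjTranspose]
  · rfl
  · intro i k l hi _ hl
    simp [Matrix.conjTranspose_apply, h i l hi hl]
  · intro i k l _ hk hl
    simp [h k l hk hl]

theorem leadMinor_one {d : ℕ} (j : ℕ) : leadMinor (1 : Mat d) j = 1 := by
  have h : (1 : Mat d).toSquareBlockProp (fun i : Fin d => (i : ℕ) < j) = 1 := by
    ext i k
    simp [Matrix.toSquareBlockProp_def, Matrix.one_apply, Subtype.ext_iff]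
  rw [leadMinor, h, Matrix.det_one]

theorem leadMinor_unitary_conj {d : ℕ} {M u : Mat d} {j : ℕ}
    (hu : u ∈ Matrix.unitaryGroup (Fin d) ℂ)
    (h : ∀ i k : Fin d, (i : ℕ) < j → ¬ (k : ℕ) < j → u k i = 0) :
    leadMinor (uᴴ * M * u) j = leadMinor M j := by
  have h1 := leadMinor_conj (M := 1) h
  rw [Matrix.mul_one, ← Matrix.star_eq_conjTranspose, Matrix.mem_unitaryGroup_iff'.1 hu,
    leadMinor_one] at h1
  rw [leadMinor_conj h]
  linear_combination (-leadMinor M j) * h1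

theorem minorPairing_unitary_conj {d : ℕ} {M u : Mat d} {f : Fin d → ℝ}
    (hu : u ∈ Matrix.unitaryGroup (Fin d) ℂ) (hf : Antitone f)
    (h : ∀ i k, f i ≠ f k → u i k = 0) :
    minorPairing f (uᴴ * M * u) = minorPairing f M := by
  set L : ℕ → ℝ := fun j =>
    Real.log (leadMinor (uᴴ * M * u) j).re - Real.log (leadMinor M j).re with hL
  have hL0 : L 0 = 0 := by
    simp only [hL]
    rw [leadMinor_unitary_conj hu (by simp), sub_self]
  have hLd : L d = 0 := by
    simp only [hL]
    rw [leadMinor_unitary_conj hu (fun _ k _ hk => absurd k.2 hk), sub_self]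
  have hLj : ∀ (j : ℕ) (hj : j + 1 < d),
      f ⟨j, by omega⟩ ≠ f ⟨j + 1, hj⟩ → L (j + 1) = 0 := by
    intro j hj hne
    simp only [hL]
    rw [leadMinor_unitary_conj hu, sub_self]
    intro i k hi hk
    apply h
    have h1 : f ⟨j, by omega⟩ ≤ f i := hf (Fin.le_def.2 (by simp; omega))
    have h2 : f k ≤ f ⟨j + 1, hj⟩ := hf (Fin.le_def.2 (by simp; omega))
    have h3 : f ⟨j + 1, hj⟩ ≤ f ⟨j, by omega⟩ := hf (Fin.le_def.2 (by simp))
    have h4 := lt_of_le_of_ne h3 hne.symm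
    linarith
  have key : ∀ (n : ℕ) (hn : n < d),
      ∑ i : Fin (n + 1), f ⟨i, by omega⟩ * (L (i + 1) - L i) = f ⟨n, hn⟩ * L (n + 1) := by
    intro n
    induction n with
    | zero => intro hn; simp [hL0]
    | succ n ih =>
      intro hn
      rw [Fin.sum_univ_castSucc]
      simp only [Fin.val_castSucc, Fin.val_last]
      rw [ih (by omega)]
      by_cases hne : f ⟨n, by omega⟩ = f ⟨n + 1, hn⟩
      · rw [hne]; ring
      · rw [hLj n hn hne]; ring
  rw [← sub_eq_zero]
  unfold minorPairing
  rw [← Finset.sum_sub_distrib]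
  obtain _ | n := d
  · simp
  · have := key n (by omega)
    rw [hLd, mul_zero] at this
    rw [← this]
    refine Finset.sum_congr rfl fun i _ => ?_
    simp only [hL]
    ring

theorem leadMinor_of_isIwasawa {d : ℕ} {g k a n : Mat d} (h : IsIwasawa g k a n) (j : ℕ) :
    leadMinor (gᴴ * g) j =
      ((∏ i : {i : Fin d // (i : ℕ) < j}, (a i i).re ^ 2 : ℝ) : ℂ) := by
  obtain ⟨rfl, hk, ⟨f, hf, rfl⟩, hn, hn1⟩ := h
  have e : (k * diagonal (fun i => (f i : ℂ)) * n)ᴴ * (k * diagonal (fun i => (f i : ℂ)) * n)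
      = nᴴ * diagonal (fun i => (f i : ℂ) ^ 2) * n := by
    have hk' : kᴴ * k = 1 := Matrix.mem_unitaryGroup_iff'.1 hk
    have hd : (diagonal (fun i => (f i : ℂ)))ᴴ * diagonal (fun i => (f i : ℂ))
        = diagonal (fun i => (f i : ℂ) ^ 2) := by
      rw [Matrix.diagonal_conjTranspose, Matrix.diagonal_mul_diagonal]
      congr 1
      ext i
      simp [sq]
    rw [← hd]
    simp only [Matrix.conjTranspose_mul, Matrix.mul_assoc]
    rw [← Matrix.mul_assoc kᴴ k, hk', Matrix.one_mul]
  have hdet : leadMinor n j = 1 := by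
    unfold leadMinor
    rw [Matrix.det_of_isUpperTriangular]
    · simp [Matrix.toSquareBlockProp_def, hn1]
    · intro i k hik
      exact hn hik
  have hdiag : leadMinor (diagonal (fun i => (f i : ℂ) ^ 2)) j
      = ∏ i : {i : Fin d // (i : ℕ) < j}, (f i : ℂ) ^ 2 := by
    unfold leadMinor
    rw [← Matrix.det_diagonal]
    congr 1
    ext i k
    simp [Matrix.toSquareBlockProp_def, Matrix.diagonal_apply, Subtype.ext_iff]
  rw [e, leadMinor_conj, hdet, hdiag]
  · simp
  · intro i k hi hk
    exact hn (show i < k from Fin.lt_def.2 (by omega))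

theorem IsIwasawa.re_pos {d : ℕ} {g k a n : Mat d} (h : IsIwasawa g k a n) (i : Fin d) :
    0 < (a i i).re := by
  obtain ⟨-, -, ⟨f, hf, rfl⟩, -⟩ := h
  simpa using hf i

theorem leadMinor_re_pos_of_isIwasawa {d : ℕ} {g k a n : Mat d} (h : IsIwasawa g k a n)
    (j : ℕ) : 0 < (leadMinor (gᴴ * g) j).re := by
  rw [leadMinor_of_isIwasawa h, Complex.ofReal_re]
  exact Finset.prod_pos fun i _ => pow_pos (h.re_pos i) 2

theorem log_leadMinor_succ_sub {d : ℕ} {g k a n : Mat d} (h : IsIwasawa g k a n) (i : Fin d) :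
    Real.log (leadMinor (gᴴ * g) (i + 1)).re - Real.log (leadMinor (gᴴ * g) i).re
      = 2 * Real.log (a i i).re := by
  have hp : ∀ j : ℕ, (leadMinor (gᴴ * g) j).re
      = ∏ i ∈ Finset.univ.filter (fun i : Fin d => (i : ℕ) < j), (a i i).re ^ 2 := by
    intro j
    rw [leadMinor_of_isIwasawa h, Complex.ofReal_re]
    symm
    exact Finset.prod_subtype _ (by simp) _
  have hs : Finset.univ.filter (fun l : Fin d => (l : ℕ) < i + 1)
      = insert i (Finset.univ.filter (fun l : Fin d => (l : ℕ) < i)) := by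
    ext l
    simp [Fin.ext_iff]
    omega
  have h0 := leadMinor_re_pos_of_isIwasawa h i
  rw [hp] at h0
  rw [hp, hp, hs, Finset.prod_insert (by simp),
    Real.log_mul (pow_pos (h.re_pos i) 2).ne' h0.ne', Real.log_pow]
  push_cast
  ring

theorem exists_isIwasawa {d : ℕ} {g : Mat d} (hg : IsUnit g.det) :
    ∃ t : Mat d × Mat d × Mat d, IsIwasawa g t.1 t.2.1 t.2.2 := by
  let v : Fin d → EuclideanSpace ℂ (Fin d) := fun j => WithLp.toLp 2 (fun i => g i j)
  let b := InnerProductSpace.gramSchmidtOrthonormalBasis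
    (𝕜 := ℂ) (E := EuclideanSpace ℂ (Fin d)) (ι := Fin d) (by simp) v
  let Q : Mat d := Matrix.of fun i j => b j i
  let R : Mat d := b.toBasis.toMatrix v
  have hR : R.BlockTriangular id :=
    InnerProductSpace.gramSchmidtOrthonormalBasis_inv_isUpperTriangular _ _
  have hQR : g = Q * R := by
    ext i j
    have := congrArg (fun w : EuclideanSpace ℂ (Fin d) => w i) (b.toBasis.sum_toMatrix_smul_self v j)
    simp only [Matrix.mul_apply]
    simp [v] at this
    rw [← this]
    exact Finset.sum_congr rfl fun k _ => mul_comm _ _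
  have hQ : Qᴴ * Q = 1 := by
    ext i j
    have := orthonormal_iff_ite.1 b.orthonormal i j
    rw [PiLp.inner_apply] at this
    simp only [Matrix.mul_apply, Matrix.one_apply, Matrix.conjTranspose_apply, Q, Matrix.of_apply]
    rw [← this]
    exact Finset.sum_congr rfl fun k _ => by simp [mul_comm]
  have hne : ∀ i, R i i ≠ 0 := by
    have h1 : R.det ≠ 0 := by
      intro h
      rw [hQR, Matrix.det_mul, h, mul_zero] at hg
      simp at hg
    rw [Matrix.det_of_isUpperTriangular hR] at h1
    exact fun i => Finset.prod_ne_zero_iff.1 h1 i (Finset.mem_univ i)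
  have hnc : ∀ i, (‖R i i‖ : ℂ) ≠ 0 := fun i => by simpa using hne i
  refine ⟨(Q * diagonal (fun i => R i i / (‖R i i‖ : ℂ)), diagonal (fun i => (‖R i i‖ : ℂ)),
    diagonal (fun i => (R i i)⁻¹) * R), ?_, ?_, ⟨fun i => ‖R i i‖, fun i => by simpa using hne i, rfl⟩,
    ?_, ?_⟩
  · simp only [Matrix.mul_assoc]
    rw [← Matrix.mul_assoc (diagonal _) (diagonal _) R, Matrix.diagonal_mul_diagonal,
      ← Matrix.mul_assoc (diagonal _) (diagonal _) R, Matrix.diagonal_mul_diagonal]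
    have : (fun i => R i i / (‖R i i‖ : ℂ) * ((‖R i i‖ : ℂ) * (R i i)⁻¹)) = fun _ => 1 := by
      ext i
      have := hne i
      have := hnc i
      field_simp
    rw [this, Matrix.diagonal_one, Matrix.one_mul, hQR]
  · refine mul_mem (Matrix.mem_unitaryGroup_iff'.2 hQ) (Matrix.mem_unitaryGroup_iff'.2 ?_)
    rw [Matrix.star_eq_conjTranspose, Matrix.diagonal_conjTranspose, Matrix.diagonal_mul_diagonal,
      ← Matrix.diagonal_one]
    congr 1
    ext i
    have h1 := hnc i
    have h2 := Complex.conj_mul' (R i i)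
    simp only [Pi.star_apply, star_div₀, RCLike.star_def, Complex.conj_ofReal]
    rw [div_mul_div_comm, h2, ← sq, div_self (pow_ne_zero 2 h1)]
  · exact (Matrix.blockTriangular_diagonal _).mul hR
  · intro i
    simp [Matrix.diagonal_mul, hne i]

theorem isIwasawa_iwaTriple {d : ℕ} {g : Mat d} (hg : IsUnit g.det) :
    IsIwasawa g (iwaTriple g).1 (iwaTriple g).2.1 (iwaTriple g).2.2 := by
  have h := exists_isIwasawa hg
  rw [iwaTriple, dif_pos h]
  exact h.choose_spec

theorem exists_isOrderedDiagonalization {d : ℕ} {x : Mat d} (hx : x.IsHermitian) :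
    ∃ p : Mat d × (Fin d → ℝ), IsOrderedDiagonalization x p.1 p.2 := by
  let σ : Equiv.Perm (Fin d) := Tuple.sort (fun i => -hx.eigenvalues i)
  let U : Mat d := hx.eigenvectorUnitary
  have hU : U ∈ Matrix.unitaryGroup (Fin d) ℂ := hx.eigenvectorUnitary.2
  have hUU : U * diagonal (fun i => (hx.eigenvalues i : ℂ)) * star U = x := by
    have := hx.spectral_theorem
    rw [Unitary.conjStarAlgAut_apply] at this
    exact this.symm
  have hσ : Monotone ((fun i => -hx.eigenvalues i) ∘ σ) := Tuple.monotone_sort _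
  refine ⟨(U.submatrix id σ, hx.eigenvalues ∘ σ), ?_, ?_, ?_⟩
  · rw [Matrix.mem_unitaryGroup_iff, Matrix.star_eq_conjTranspose, Matrix.conjTranspose_submatrix,
      Matrix.submatrix_mul_equiv, ← Matrix.star_eq_conjTranspose, Matrix.mem_unitaryGroup_iff.1 hU]
    simp
  · intro i j hij
    simpa using hσ hij
  · have : diagonal (fun i => (((hx.eigenvalues ∘ σ) i : ℝ) : ℂ))
        = (diagonal (fun i => (hx.eigenvalues i : ℂ))).submatrix σ σ := by
      rw [Matrix.submatrix_diagonal_equiv]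
      rfl
    simp only
    rw [this, Matrix.star_eq_conjTranspose, Matrix.conjTranspose_submatrix,
      Matrix.submatrix_mul_equiv, Matrix.submatrix_mul_equiv, ← Matrix.star_eq_conjTranspose, hUU]
    simp

theorem isOrderedDiagonalization_specPair {d : ℕ} {x : Mat d} (hx : x.IsHermitian) :
    IsOrderedDiagonalization x (specPair x).1 (specPair x).2 := by
  have h := exists_isOrderedDiagonalization hx
  rw [specPair, dif_pos h]
  exact h.choose_spec

/-- Two ordered diagonalizations have the same eigenvalues, and the transition matrix preserves
the eigenspaces. -/
theorem IsOrderedDiagonalization.compare {d : ℕ} {x h h' : Mat d} {f f' : Fin d → ℝ}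
    (H : IsOrderedDiagonalization x h f) (H' : IsOrderedDiagonalization x h' f') :
    f = f' ∧ ∀ i k, f i ≠ f k → (star h' * h) i k = 0 := by
  obtain ⟨hu, hf, rfl⟩ := H
  obtain ⟨hu', hf', hx⟩ := H'
  have e : star h' * h * diagonal (fun i => (f i : ℂ))
      = diagonal (fun i => (f' i : ℂ)) * (star h' * h) := by
    have h1 : star h * h = 1 := Matrix.mem_unitaryGroup_iff'.1 hu
    have h2 : star h' * h' = 1 := Matrix.mem_unitaryGroup_iff'.1 hu'
    have := congrArg (fun y => star h' * y * h) hx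
    simp only [Matrix.mul_assoc] at this
    rw [h1, Matrix.mul_one, ← Matrix.mul_assoc (star h') h', h2, Matrix.one_mul] at this
    rw [Matrix.mul_assoc, this]
  have hz : ∀ i k, f' i ≠ f k → (star h' * h) i k = 0 := by
    intro i k hik
    have := congrFun (congrFun e i) k
    rw [Matrix.mul_diagonal, Matrix.diagonal_mul] at this
    have h0 : ((f' i : ℂ) - f k) * (star h' * h) i k = 0 := by linear_combination -this
    refine (mul_eq_zero.1 h0).resolve_left ?_
    exact sub_ne_zero.2 (by exact_mod_cast hik)
  have hmem : star h' * h ∈ Matrix.unitaryGroup (Fin d) ℂ := mul_mem (Unitary.star_mem hu') hu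
  have hdet : (star h' * h).det ≠ 0 := by
    intro h0
    have := congrArg Matrix.det (Matrix.mem_unitaryGroup_iff.1 hmem)
    rw [Matrix.det_mul, h0] at this
    simp at this
  obtain ⟨σ, hσ⟩ : ∃ σ : Equiv.Perm (Fin d), ∀ i, f' (σ i) = f i := by
    by_contra! hcon
    apply hdet
    rw [Matrix.det_apply]
    refine Finset.sum_eq_zero fun σ _ => ?_
    obtain ⟨i, hi⟩ := hcon σ
    have h0 : ∏ l, (star h' * h) (σ l) l = 0 :=
      Finset.prod_eq_zero (Finset.mem_univ i) (hz _ _ hi)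
    rw [h0, smul_zero]
  have hff : f = f' := by
    have h1 : Monotone ((fun i => -f' i) ∘ σ) := by
      intro i j hij
      simpa [hσ] using hf hij
    have h2 : Monotone ((fun i => -f' i) ∘ (1 : Equiv.Perm (Fin d))) := by
      intro i j hij
      simpa using hf' hij
    have h3 := Tuple.unique_monotone h1 h2
    ext i
    have := congrFun h3 i
    simp [hσ] at this
    exact this
  exact ⟨hff, fun i k hik => hz i k (by rwa [← hff])⟩

theorem isUnit_det_mul_unitary {d : ℕ} {g h : Mat d} (hg : IsUnit g.det)
    (hh : h ∈ Matrix.unitaryGroup (Fin d) ℂ) : IsUnit (g * h).det := by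
  rw [Matrix.det_mul]
  refine hg.mul ?_
  exact (Matrix.isUnit_iff_isUnit_det _).1 ⟨Unitary.toUnits ⟨h, hh⟩, rfl⟩

/-- `χ_x(g)` computed from an arbitrary ordered diagonalization of `x`. -/
theorem chi_eq_exp_minorPairing {d : ℕ} {x h g : Mat d} {f : Fin d → ℝ}
    (H : IsOrderedDiagonalization x h f) (hx : x.IsHermitian) (hg : IsUnit g.det) :
    chi x g = Real.exp (minorPairing f ((g * h)ᴴ * (g * h))) := by
  have H' := isOrderedDiagonalization_specPair hx
  have hI := isIwasawa_iwaTriple (isUnit_det_mul_unitary hg H'.1)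
  obtain ⟨hff, hz⟩ := H'.compare H
  have hmem : star h * (specPair x).1 ∈ Matrix.unitaryGroup (Fin d) ℂ :=
    mul_mem (Unitary.star_mem H.1) H'.1
  have e := minorPairing_unitary_conj (M := (g * h)ᴴ * (g * h)) hmem H'.2.1 hz
  have e2 : (star h * (specPair x).1)ᴴ * ((g * h)ᴴ * (g * h)) * (star h * (specPair x).1)
      = (g * (specPair x).1)ᴴ * (g * (specPair x).1) := by
    have : g * h * (star h * (specPair x).1) = g * (specPair x).1 := by
      rw [Matrix.mul_assoc, ← Matrix.mul_assoc h, Matrix.mem_unitaryGroup_iff.1 H.1,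
        Matrix.one_mul]
    rw [← this]
    simp only [Matrix.conjTranspose_mul, Matrix.mul_assoc]
  rw [e2] at e
  rw [← hff, ← e, chi, iwaAlpha, Matrix.diagonal_mul_diagonal, Matrix.trace_diagonal, minorPairing,
    Finset.mul_sum]
  congr 1
  refine Finset.sum_congr rfl fun i _ => ?_
  rw [log_leadMinor_succ_sub hI]
  ring

theorem continuous_leadMinor {d : ℕ} (j : ℕ) : Continuous fun M : Mat d => leadMinor M j := by
  unfold leadMinor
  refine Continuous.matrix_det ?_
  exact continuous_matrix fun i k => continuous_id.matrix_elem _ _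

theorem isCompact_unitaryGroup (d : ℕ) :
    IsCompact (Matrix.unitaryGroup (Fin d) ℂ : Set (Mat d)) := by
  have hK : IsCompact (Set.pi Set.univ fun _ : Fin d => Set.pi Set.univ fun _ : Fin d =>
      Metric.closedBall (0 : ℂ) 1) :=
    isCompact_univ_pi fun _ => isCompact_univ_pi fun _ => isCompact_closedBall _ _
  refine hK.of_isClosed_subset ?_ ?_
  · have : (Matrix.unitaryGroup (Fin d) ℂ : Set (Mat d)) = {u | u * star u = 1} := by
      ext u
      exact Matrix.mem_unitaryGroup_iff
    rw [this]
    exact isClosed_eq (continuous_id.matrix_mul continuous_star) continuous_const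
  · intro u hu i _ j _
    simpa using entry_norm_bound_of_unitary hu i j

theorem continuous_chi (d : ℕ) :
    Continuous (fun p : {x : Mat d // x.IsHermitian} × GL (Fin d) ℂ =>
      chi (↑p.1 : Mat d) (↑p.2 : Mat d)) := by
  have hdet : ∀ g : GL (Fin d) ℂ, IsUnit (g : Mat d).det := fun g =>
    (Matrix.isUnit_iff_isUnit_det _).1 g.isUnit
  rw [continuous_iff_continuousAt]
  intro p₀
  rw [ContinuousAt, Filter.tendsto_iff_ultrafilter]
  intro u hu
  set h : {x : Mat d // x.IsHermitian} × GL (Fin d) ℂ → Mat d :=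
    fun p => (specPair (p.1 : Mat d)).1
  set f : {x : Mat d // x.IsHermitian} × GL (Fin d) ℂ → Fin d → ℝ :=
    fun p => (specPair (p.1 : Mat d)).2
  have H : ∀ p, IsOrderedDiagonalization (p.1 : Mat d) (h p) (f p) :=
    fun p => isOrderedDiagonalization_specPair p.1.2
  obtain ⟨h₀, hh₀, hlim⟩ := isCompact_iff_ultrafilter_le_nhds.1 (isCompact_unitaryGroup d)
    (u.map h) (by
      rw [Filter.le_principal_iff]
      exact Filter.mem_map.2 (Filter.univ_mem' fun p => (H p).1))
  replace hlim : Filter.Tendsto h u (nhds h₀) := hlim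
  have hxlim : Filter.Tendsto (fun p : {x : Mat d // x.IsHermitian} × GL (Fin d) ℂ =>
      (p.1 : Mat d)) u (nhds (p₀.1 : Mat d)) :=
    ((continuous_subtype_val.comp continuous_fst).tendsto p₀).mono_left hu
  have hglim : Filter.Tendsto (fun p : {x : Mat d // x.IsHermitian} × GL (Fin d) ℂ =>
      (p.2 : Mat d)) u (nhds (p₀.2 : Mat d)) :=
    ((Units.continuous_val.comp continuous_snd).tendsto p₀).mono_left hu
  have hdiag : ∀ p, diagonal (fun i => (f p i : ℂ)) = star (h p) * (p.1 : Mat d) * h p := by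
    intro p
    obtain ⟨h1, -, h2⟩ := H p
    have h3 := Matrix.mem_unitaryGroup_iff'.1 h1
    rw [h2]
    simp only [Matrix.mul_assoc]
    rw [h3, Matrix.mul_one, ← Matrix.mul_assoc, h3, Matrix.one_mul]
  have hD : Filter.Tendsto (fun p => diagonal (fun i => (f p i : ℂ))) u
      (nhds (star h₀ * (p₀.1 : Mat d) * h₀)) := by
    simp only [hdiag]
    exact (hlim.star.mul hxlim).mul hlim
  set f₀ : Fin d → ℝ := fun i => ((star h₀ * (p₀.1 : Mat d) * h₀) i i).re
  have hflim : Filter.Tendsto f u (nhds f₀) := by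
    rw [tendsto_pi_nhds]
    intro i
    have := ((Complex.continuous_re.comp (continuous_id.matrix_elem i i)).tendsto _).comp hD
    simpa [Function.comp_def] using this
  have hD₀ : Filter.Tendsto (fun p => diagonal (fun i => (f p i : ℂ))) u
      (nhds (diagonal (fun i => (f₀ i : ℂ)))) := by
    have hc : Continuous fun φ : Fin d → ℝ => (diagonal (fun i => (φ i : ℂ)) : Mat d) :=
      Continuous.matrix_diagonal (by fun_prop)
    exact (hc.tendsto f₀).comp hflim
  have H₀ : IsOrderedDiagonalization (p₀.1 : Mat d) h₀ f₀ := by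
    refine ⟨hh₀, ?_, ?_⟩
    · intro i j hij
      exact le_of_tendsto_of_tendsto' (tendsto_pi_nhds.1 hflim j) (tendsto_pi_nhds.1 hflim i)
        fun p => (H p).2.1 hij
    · have hlim' := (hlim.mul hD₀).mul hlim.star
      have he : (fun p => h p * diagonal (fun i => (f p i : ℂ)) * star (h p))
          = fun p => (p.1 : Mat d) := funext fun p => (H p).2.2.symm
      rw [he] at hlim'
      exact tendsto_nhds_unique hxlim hlim'
  have hval : ∀ p : {x : Mat d // x.IsHermitian} × GL (Fin d) ℂ, chi (p.1 : Mat d) (p.2 : Mat d)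
      = Real.exp (minorPairing (f p) (((p.2 : Mat d) * h p)ᴴ * ((p.2 : Mat d) * h p))) :=
    fun p => chi_eq_exp_minorPairing (H p) p.1.2 (hdet p.2)
  have hval₀ := chi_eq_exp_minorPairing H₀ p₀.1.2 (hdet p₀.2)
  simp only [hval₀]
  simp only [hval]
  refine (Real.continuous_exp.tendsto _).comp ?_
  have hM : Filter.Tendsto (fun p => ((p.2 : Mat d) * h p)ᴴ * ((p.2 : Mat d) * h p)) u
      (nhds (((p₀.2 : Mat d) * h₀)ᴴ * ((p₀.2 : Mat d) * h₀))) :=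
    (hglim.mul hlim).star.mul (hglim.mul hlim)
  have hlog : ∀ j : ℕ, Filter.Tendsto (fun p =>
      Real.log (leadMinor (((p.2 : Mat d) * h p)ᴴ * ((p.2 : Mat d) * h p)) j).re) u
      (nhds (Real.log (leadMinor (((p₀.2 : Mat d) * h₀)ᴴ * ((p₀.2 : Mat d) * h₀)) j).re)) := by
    intro j
    have hpos := leadMinor_re_pos_of_isIwasawa
      (isIwasawa_iwaTriple (isUnit_det_mul_unitary (hdet p₀.2) hh₀)) j
    exact (((Complex.continuous_re.comp (continuous_leadMinor j)).tendsto _).comp hM).log hpos.ne'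
  unfold minorPairing
  exact tendsto_finsetSum _ fun i _ =>
    (tendsto_pi_nhds.1 hflim i).mul ((hlog (i + 1)).sub (hlog i))

theorem chi_unitary_conj {d : ℕ} {k x g : Mat d} (hk : k ∈ Matrix.unitaryGroup (Fin d) ℂ)
    (hx : x.IsHermitian) (hg : IsUnit g.det) : chi (k * x * star k) (g * k⁻¹) = chi x g := by
  have H := isOrderedDiagonalization_specPair hx
  set h := (specPair x).1
  set f := (specPair x).2
  have hkinv : k⁻¹ = star k := Matrix.inv_eq_right_inv (Matrix.mem_unitaryGroup_iff.1 hk)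
  have H' : IsOrderedDiagonalization (k * x * star k) (k * h) f := by
    refine ⟨mul_mem hk H.1, H.2.1, ?_⟩
    conv_lhs => rw [H.2.2]
    simp only [star_mul, Matrix.mul_assoc]
  have hx' : (k * x * star k).IsHermitian := Matrix.isHermitian_mul_mul_conjTranspose k hx
  rw [chi_eq_exp_minorPairing H hx hg, chi_eq_exp_minorPairing H' hx' (by
    rw [hkinv]
    exact isUnit_det_mul_unitary hg (Unitary.star_mem hk))]
  have : g * k⁻¹ * (k * h) = g * h := by
    rw [hkinv, Matrix.mul_assoc, ← Matrix.mul_assoc (star k), Matrix.mem_unitaryGroup_iff'.1 hk,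
      Matrix.one_mul]
  rw [this]

theorem stmt4 (d : ℕ) (hd : 1 ≤ d) :
    Continuous (fun p : {x : Mat d // x.IsHermitian} × GL (Fin d) ℂ =>
      chi (↑p.1 : Mat d) (↑p.2 : Mat d))
    ∧ (∀ k : Mat d, k ∈ Matrix.unitaryGroup (Fin d) ℂ → ∀ x : Mat d, x.IsHermitian →
        ∀ g : GL (Fin d) ℂ, chi (k * x * star k) ((↑g : Mat d) * k⁻¹) = chi x (↑g : Mat d)) := by
  exact ⟨continuous_chi d, fun k hk x hx g =>
    chi_unitary_conj hk hx ((Matrix.isUnit_iff_isUnit_det _).1 g.isUnit)⟩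

end
end

section
/- Let x₀, x₀' be real diagonal d×d matrices with nonincreasing diagonal entries, let h be unitary, and set x = h x₀ h*, x' = h x₀' h*. Then the orbit of x' under the unitary stabilizer of x equals its orbit under the GL(d,ℂ)-stabilizer of x: {u x' u* : u unitary, u x u* = x} = {g·x' : g ∈ GL(d,ℂ), g·x = x}. -/
open Matrix
open scoped ComplexOrder

noncomputable section
open scoped Classical

/-- The extended action of `GL(d, ℂ)` on hermitian matrices: `g · (h x₀ h*) = k(gh) x₀ k(gh)*`. -/
def gAct {d : ℕ} (g x : Mat d) : Mat d :=
  iwaK (g * (specPair x).1) * Matrix.diagonal (fun i => (((specPair x).2 i : ℝ) : ℂ)) *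
    star (iwaK (g * (specPair x).1))

/-- Gram-Schmidt applied to the columns of `g` gives an Iwasawa decomposition. -/
theorem exists_isIwasawa_s5 {d : ℕ} (g : Mat d) (hg : IsUnit g) :
    ∃ k a n : Mat d, IsIwasawa g k a n := by
  let v : Fin d → EuclideanSpace ℂ (Fin d) := fun j => WithLp.toLp 2 (g.col j)
  have hv : LinearIndependent ℂ v :=
    (Matrix.linearIndependent_cols_of_isUnit hg).map' (WithLp.linearEquiv 2 ℂ _).symm.toLinearMap
      (LinearEquiv.ker _)
  let u := InnerProductSpace.gramSchmidt ℂ v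
  have hu : ∀ i, u i ≠ 0 := fun i => InnerProductSpace.gramSchmidt_ne_zero i hv
  have hw := InnerProductSpace.gramSchmidtNormed_orthonormal hv
  let k : Mat d := Matrix.of fun i j => InnerProductSpace.gramSchmidtNormed ℂ v j i
  let n : Mat d := Matrix.of fun i j =>
    if i < j then inner ℂ (u i) (v j) / ((‖u i‖ : ℂ) ^ 2) else if i = j then 1 else 0
  refine ⟨k, Matrix.diagonal fun i => (‖u i‖ : ℂ), n, ?_, ?_,
    ⟨fun i => ‖u i‖, fun i => norm_pos_iff.2 (hu i), rfl⟩, ?_, ?_⟩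
  · have hku : ∀ i j, (k * Matrix.diagonal fun i => (‖u i‖ : ℂ)) i j = u j i := by
      intro i j
      have : (‖u j‖ : ℂ) ≠ 0 := by exact_mod_cast norm_ne_zero_iff.2 (hu j)
      simp only [k, Matrix.mul_diagonal, Matrix.of_apply, InnerProductSpace.gramSchmidtNormed,
        PiLp.smul_apply, smul_eq_mul]
      change ((‖u j‖ : ℂ)⁻¹ * u j i) * _ = _
      field_simp
    ext i j
    have h1 := congrArg (fun w : EuclideanSpace ℂ (Fin d) => w i)
      (InnerProductSpace.gramSchmidt_def'' ℂ v j)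
    have h2 : ∀ l, u l i * n l j = (if l = j then u l i else 0) +
        if l < j then (inner ℂ (u l) (v j) / ((‖u l‖ : ℂ) ^ 2)) * u l i else 0 := by
      intro l
      rcases lt_trichotomy l j with h | h | h
      · simp [n, h, h.ne, mul_comm]
      · simp [n, h]
      · simp [n, h.not_gt, h.ne']
    rw [Matrix.mul_apply]
    simp_rw [hku, h2]
    rw [Finset.sum_add_distrib, Finset.sum_ite_eq' Finset.univ j, ← Finset.sum_filter,
      Finset.filter_gt_eq_Iio]
    simpa [v] using h1
  · rw [Matrix.mem_unitaryGroup_iff']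
    ext i j
    have := (orthonormal_iff_ite.1 hw) i j
    rw [PiLp.inner_apply] at this
    simp only [RCLike.inner_apply] at this
    simp only [Matrix.mul_apply, Matrix.star_apply, Matrix.one_apply, k, Matrix.of_apply]
    rw [← this]
    exact Finset.sum_congr rfl fun l _ => mul_comm _ _
  · intro i j hij
    have hji : j < i := hij
    simp [n, hji.not_gt, hji.ne']
  · intro i
    simp [n]

theorem IsIwasawa.blockTriangular {d : ℕ} {g k a n : Mat d} (h : IsIwasawa g k a n) :
    (a * n).BlockTriangular id := by
  obtain ⟨-, -, ⟨f, -, rfl⟩, hn, -⟩ := h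
  exact (Matrix.blockTriangular_diagonal _).mul hn

theorem exists_eq_iwaK_mul {d : ℕ} (g : Mat d) (hg : IsUnit g) :
    iwaK g ∈ Matrix.unitaryGroup (Fin d) ℂ ∧
      ∃ p : Mat d, p.BlockTriangular id ∧ g = iwaK g * p := by
  have hex : ∃ t : Mat d × Mat d × Mat d, IsIwasawa g t.1 t.2.1 t.2.2 := by
    obtain ⟨k, a, n, h⟩ := exists_isIwasawa_s5 g hg
    exact ⟨(k, a, n), h⟩
  have hspec : IsIwasawa g (iwaTriple g).1 (iwaTriple g).2.1 (iwaTriple g).2.2 := by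
    rw [iwaTriple, dif_pos hex]
    exact hex.choose_spec
  exact ⟨hspec.2.1, _, hspec.blockTriangular, by
    rw [← Matrix.mul_assoc]; exact hspec.1⟩

/-- A matrix commutes with a diagonal matrix iff it vanishes between distinct eigenspaces. -/
theorem mul_diagonal_eq_diagonal_mul_iff {d : ℕ} (m : Mat d) (f f' : Fin d → ℝ) :
    m * Matrix.diagonal (fun i => (f i : ℂ)) = Matrix.diagonal (fun i => (f' i : ℂ)) * m ↔
      ∀ i j, f' i ≠ f j → m i j = 0 := by
  rw [← Matrix.ext_iff]
  refine forall₂_congr fun i j => ?_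
  rw [Matrix.mul_diagonal, Matrix.diagonal_mul]
  constructor
  · intro h hne
    have h' : ((f' i : ℂ) - f j) * m i j = 0 := by linear_combination -h
    refine (mul_eq_zero.1 h').resolve_left fun h0 => hne ?_
    exact_mod_cast sub_eq_zero.1 h0
  · intro h
    by_cases hne : f' i = f j
    · rw [hne, mul_comm]
    · simp [h hne]

theorem eq_of_mul_diagonal_eq {d : ℕ} {m : Mat d} (hm : IsUnit m) {f f' : Fin d → ℝ}
    (hf : Antitone f) (hf' : Antitone f')
    (h : m * Matrix.diagonal (fun i => (f i : ℂ)) = Matrix.diagonal (fun i => (f' i : ℂ)) * m) :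
    f = f' := by
  rw [mul_diagonal_eq_diagonal_mul_iff] at h
  have hdet : m.det ≠ 0 := ((Matrix.isUnit_iff_isUnit_det m).1 hm).ne_zero
  rw [Matrix.det_apply] at hdet
  obtain ⟨σ, -, hσ⟩ := Finset.exists_ne_zero_of_sum_ne_zero hdet
  have hfσ : f = f' ∘ σ := by
    funext i
    by_contra hne
    refine hσ ?_
    have h0 : ∏ j, m (σ j) j = 0 :=
      Finset.prod_eq_zero (Finset.mem_univ i) (h _ _ (Ne.symm hne))
    exact (congrArg _ h0).trans (smul_zero _)
  have := Tuple.unique_antitone (f := f') (σ := σ) (τ := 1) (hfσ ▸ hf) (by simpa using hf')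
  rw [hfσ, this]
  rfl

theorem isUnit_of_mem_unitaryGroup {d : ℕ} {u : Mat d}
    (hu : u ∈ Matrix.unitaryGroup (Fin d) ℂ) : IsUnit u :=
  ⟨⟨u, star u, Matrix.mem_unitaryGroup_iff.1 hu, Matrix.mem_unitaryGroup_iff'.1 hu⟩, rfl⟩

/-- A block triangular unitary matrix is block diagonal. -/
theorem mul_diagonal_comm_of_blockTriangular {d : ℕ} {u : Mat d}
    (hu : u ∈ Matrix.unitaryGroup (Fin d) ℂ) {f : Fin d → ℝ}
    (ht : u.BlockTriangular fun i => -f i) :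
    u * Matrix.diagonal (fun i => (f i : ℂ)) = Matrix.diagonal (fun i => (f i : ℂ)) * u := by
  rw [mul_diagonal_eq_diagonal_mul_iff]
  intro i j hij
  rcases lt_or_gt_of_ne hij with h | h
  · exact ht (neg_lt_neg h)
  · let := (isUnit_of_mem_unitaryGroup hu).invertible
    have hinv := Matrix.blockTriangular_inv_of_blockTriangular ht
    rw [Matrix.inv_eq_left_inv (Matrix.mem_unitaryGroup_iff'.1 hu)] at hinv
    have := hinv (i := j) (j := i) (neg_lt_neg h)
    simpa [Matrix.star_apply] using this

theorem blockTriangular_neg_of_antitone {d : ℕ} {p : Mat d} (hp : p.BlockTriangular id)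
    {f : Fin d → ℝ} (hf : Antitone f) : p.BlockTriangular fun i => -f i :=
  fun _ _ hij => hp (hf.neg.reflect_lt hij)

/-- If `k₁ p₁` and `k₂ p₂` differ on the right by a unitary matrix commuting with `x₀`, then the
unitary factors `k₁`, `k₂` conjugate `x₀` to the same matrix. -/
theorem conj_diagonal_eq_of_mul_eq {d : ℕ} {k₁ k₂ p₁ p₂ m : Mat d} {f : Fin d → ℝ}
    (hf : Antitone f)
    (hk₁ : k₁ ∈ Matrix.unitaryGroup (Fin d) ℂ) (hk₂ : k₂ ∈ Matrix.unitaryGroup (Fin d) ℂ)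
    (hp₁ : p₁.BlockTriangular id) (hp₂ : p₂.BlockTriangular id) (hu : IsUnit p₂)
    (hm : m * Matrix.diagonal (fun i => (f i : ℂ)) = Matrix.diagonal (fun i => (f i : ℂ)) * m)
    (h : k₁ * p₁ * m = k₂ * p₂) :
    k₁ * Matrix.diagonal (fun i => (f i : ℂ)) * star k₁ =
      k₂ * Matrix.diagonal (fun i => (f i : ℂ)) * star k₂ := by
  let := hu.invertible
  have hw : star k₁ * k₂ = p₁ * m * p₂⁻¹ := by
    have h1 : k₂ = k₁ * p₁ * m * p₂⁻¹ := by
      rw [h, Matrix.mul_assoc, Matrix.mul_inv_of_invertible, Matrix.mul_one]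
    rw [h1]
    simp only [← Matrix.mul_assoc]
    rw [Matrix.mem_unitaryGroup_iff'.1 hk₁, Matrix.one_mul]
  have hmt : m.BlockTriangular fun i => -f i := fun i j hij =>
    (mul_diagonal_eq_diagonal_mul_iff m f f).1 hm i j (neg_lt_neg_iff.1 hij).ne
  have hwt : (star k₁ * k₂).BlockTriangular fun i => -f i := by
    rw [hw]
    exact ((blockTriangular_neg_of_antitone hp₁ hf).mul hmt).mul
      (Matrix.blockTriangular_inv_of_blockTriangular (blockTriangular_neg_of_antitone hp₂ hf))
  have hcomm := mul_diagonal_comm_of_blockTriangular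
    (mul_mem (Unitary.star_mem hk₁) hk₂) hwt
  have h₁ := Matrix.mem_unitaryGroup_iff.1 hk₁
  have h₂ := Matrix.mem_unitaryGroup_iff.1 hk₂
  calc k₁ * Matrix.diagonal (fun i => (f i : ℂ)) * star k₁
      = k₁ * (Matrix.diagonal (fun i => (f i : ℂ)) * (star k₁ * k₂)) * star k₂ := by
        simp only [Matrix.mul_assoc, h₂, Matrix.mul_one]
    _ = (k₁ * star k₁) * k₂ * Matrix.diagonal (fun i => (f i : ℂ)) * star k₂ := by
        rw [← hcomm]; simp only [Matrix.mul_assoc]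
    _ = _ := by rw [h₁, Matrix.one_mul]

/-- The action may be computed from any ordered diagonalization of `x` and any factorization of
`g h` into a unitary and an upper triangular matrix. -/
theorem gAct_eq {d : ℕ} {g x h k p : Mat d} {f : Fin d → ℝ} (hg : IsUnit g)
    (hx : IsOrderedDiagonalization x h f) (hk : k ∈ Matrix.unitaryGroup (Fin d) ℂ)
    (hp : p.BlockTriangular id) (hgh : g * h = k * p) :
    gAct g x = k * Matrix.diagonal (fun i => (f i : ℂ)) * star k := by
  have hex : ∃ q : Mat d × (Fin d → ℝ), IsOrderedDiagonalization x q.1 q.2 := ⟨(h, f), hx⟩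
  have hs : IsOrderedDiagonalization x (specPair x).1 (specPair x).2 := by
    rw [specPair, dif_pos hex]
    exact hex.choose_spec
  rw [gAct]
  generalize (specPair x).1 = h₀ at hs ⊢
  generalize (specPair x).2 = f₀ at hs ⊢
  obtain ⟨hh, hf, hx⟩ := hx
  obtain ⟨hh₀, hf₀, hx₀⟩ := hs
  have hm : star h₀ * h * Matrix.diagonal (fun i => (f i : ℂ)) =
      Matrix.diagonal (fun i => (f₀ i : ℂ)) * (star h₀ * h) := by
    calc star h₀ * h * Matrix.diagonal (fun i => (f i : ℂ))
        = star h₀ * (h * Matrix.diagonal (fun i => (f i : ℂ)) * star h) * h := by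
          simp only [Matrix.mul_assoc, Matrix.mem_unitaryGroup_iff'.1 hh, Matrix.mul_one]
      _ = (star h₀ * h₀) * Matrix.diagonal (fun i => (f₀ i : ℂ)) * (star h₀ * h) := by
          rw [← hx, hx₀]; simp only [Matrix.mul_assoc]
      _ = _ := by rw [Matrix.mem_unitaryGroup_iff'.1 hh₀, Matrix.one_mul]
  have hff : f = f₀ := eq_of_mul_diagonal_eq
    (isUnit_of_mem_unitaryGroup (mul_mem (Unitary.star_mem hh₀) hh)) hf hf₀ hm
  subst hff
  obtain ⟨hk₀, p₀, hp₀, hgp⟩ :=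
    exists_eq_iwaK_mul (g * h₀) (hg.mul (isUnit_of_mem_unitaryGroup hh₀))
  have hpu : IsUnit p := by
    have : p = star k * (g * h) := by
      rw [hgh, ← Matrix.mul_assoc, Matrix.mem_unitaryGroup_iff'.1 hk, Matrix.one_mul]
    rw [this]
    exact (isUnit_of_mem_unitaryGroup (Unitary.star_mem hk)).mul
      (hg.mul (isUnit_of_mem_unitaryGroup hh))
  refine conj_diagonal_eq_of_mul_eq hf hk₀ hk hp₀ hp hpu hm ?_
  rw [← hgp, ← hgh, Matrix.mul_assoc, ← Matrix.mul_assoc h₀,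
    Matrix.mem_unitaryGroup_iff.1 hh₀, Matrix.one_mul]

/-- On unitary matrices the action is conjugation. -/
theorem gAct_of_mem_unitaryGroup {d : ℕ} {u x h : Mat d} {f : Fin d → ℝ}
    (hu : u ∈ Matrix.unitaryGroup (Fin d) ℂ) (hx : IsOrderedDiagonalization x h f) :
    gAct u x = u * x * star u := by
  rw [gAct_eq (isUnit_of_mem_unitaryGroup hu) hx (mul_mem hu hx.1)
    Matrix.blockTriangular_one (Matrix.mul_one _).symm, hx.2.2, star_mul]
  simp only [Matrix.mul_assoc]

theorem stmt5 (d : ℕ) (hd : 1 ≤ d) (f f' : Fin d → ℝ) (hf : Antitone f) (hf' : Antitone f')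
    (h : Mat d) (hh : h ∈ Matrix.unitaryGroup (Fin d) ℂ)
    (x x' : Mat d)
    (hx : x = h * Matrix.diagonal (fun i => (f i : ℂ)) * star h)
    (hx' : x' = h * Matrix.diagonal (fun i => (f' i : ℂ)) * star h) :
    {y : Mat d | ∃ u : Mat d, u ∈ Matrix.unitaryGroup (Fin d) ℂ ∧ u * x * star u = x ∧
        y = u * x' * star u}
      = {y : Mat d | ∃ g : GL (Fin d) ℂ, gAct (↑g : Mat d) x = x ∧ y = gAct (↑g : Mat d) x'} := by
  have hX : IsOrderedDiagonalization x h f := ⟨hh, hf, hx⟩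
  have hX' : IsOrderedDiagonalization x' h f' := ⟨hh, hf', hx'⟩
  ext y
  constructor
  · rintro ⟨u, hu, hux, rfl⟩
    obtain ⟨g, rfl⟩ := isUnit_of_mem_unitaryGroup hu
    exact ⟨g, by rw [gAct_of_mem_unitaryGroup hu hX, hux],
      (gAct_of_mem_unitaryGroup hu hX').symm⟩
  · rintro ⟨g, hgx, rfl⟩
    obtain ⟨hk, p, hp, hgp⟩ :=
      exists_eq_iwaK_mul ((g : Mat d) * h) (g.isUnit.mul (isUnit_of_mem_unitaryGroup hh))
    generalize iwaK ((g : Mat d) * h) = k at hk hgp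
    have key : ∀ D : Mat d, k * star h * (h * D * star h) * star (k * star h) =
        k * D * star k := by
      intro D
      have h1 := Matrix.mem_unitaryGroup_iff'.1 hh
      calc k * star h * (h * D * star h) * star (k * star h)
          = k * (star h * h) * D * (star h * h) * star k := by
            rw [star_mul, star_star]; simp only [Matrix.mul_assoc]
        _ = k * D * star k := by rw [h1, Matrix.mul_one, Matrix.mul_one]
    refine ⟨k * star h, mul_mem hk (Unitary.star_mem hh), ?_, ?_⟩
    · conv_lhs => rw [hx]
      rw [key, ← gAct_eq g.isUnit hX hk hp hgp, hgx]
    · rw [hx', key, ← hx', gAct_eq g.isUnit hX' hk hp hgp]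

end
end
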